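/- arXiv:1011.1183 — 2 statements merged into one kernel-verified Lean document; each statement's English description precedes it below -/
import Mathlib

section
/- Let G be a group, B ≤ G a subgroup, and 1 → R → Q → S → 1 a central extension of G-groups. If the restriction maps R^G → R^B and S^G → S^B are surjective and the restriction map H^1(G,R) → H^1(B,R) is injective, then the restriction map Q^G → Q^B is surjective. Moreover, if R^G → R^B and S^G → S^B are injective, then Q^G → Q^B is injective; hence if R^G → R^B and S^G → S^B are bijective and H^1(G,R) → H^1(B,R) is injective, then Q^G → Q^B is bijective. -/
/-- A right action of a group `G` on a group `Q` by group automorphisms,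
written `q ↦ q^g` in the paper; here `act q g`. -/
structure GAction (G : Type*) (Q : Type*) [Group G] [Group Q] where
  act : Q → G → Q
  act_one : ∀ q, act q 1 = q
  act_mul : ∀ q g h, act (act q g) h = act q (g * h)
  act_map_mul : ∀ g q q', act (q * q') g = act q g * act q' g

namespace GAction

variable {G Q : Type*} [Group G] [Group Q]

/-- `γ : G → Q` is a 1-cocycle: `γ(gh) = γ(g)^h · γ(h)`. -/
def IsCocycle (A : GAction G Q) (γ : G → Q) : Prop :=
  ∀ g h : G, γ (g * h) = A.act (γ g) h * γ h

/-- Two 1-cochains are cohomologous: `δ(g) = (q^g)⁻¹ · γ(g) · q` for some `q`. -/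
def Cohomologous (A : GAction G Q) (γ δ : G → Q) : Prop :=
  ∃ q : Q, ∀ g : G, δ g = (A.act q g)⁻¹ * γ g * q

/-- `τ : G × G → Q` is a 2-cocycle: `τ(g,h)^k · τ(gh,k) = τ(h,k) · τ(g,hk)`. -/
def IsTwoCocycle (A : GAction G Q) (τ : G → G → Q) : Prop :=
  ∀ g h k : G, A.act (τ g h) k * τ (g * h) k = τ h k * τ g (h * k)

/-- Two 2-cochains are cohomologous:
`τ'(g,h) = τ(g,h) · φ(g)^h · φ(h) · φ(gh)⁻¹` for some `φ : G → Q`. -/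
def TwoCohomologous (A : GAction G Q) (τ τ' : G → G → Q) : Prop :=
  ∃ φ : G → Q, ∀ g h : G, τ' g h = τ g h * A.act (φ g) h * φ h * (φ (g * h))⁻¹

/-- The restriction of a `G`-action to a subgroup `B ≤ G`. -/
def res (A : GAction G Q) (B : Subgroup G) : GAction B Q where
  act q b := A.act q (b : G)
  act_one q := by simpa using A.act_one q
  act_mul q b c := by simpa using A.act_mul q (b : G) (c : G)
  act_map_mul b q q' := A.act_map_mul (b : G) q q'

end GAction

/-- `1 → R →(ι) Q →(π) S → 1` is a central extension of `G`-groups. -/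
structure IsCentralExt {G R Q S : Type*} [Group G] [Group R] [Group Q] [Group S]
    (AR : GAction G R) (AQ : GAction G Q) (AS : GAction G S)
    (ι : R →* Q) (π : Q →* S) : Prop where
  ι_inj : Function.Injective ι
  π_surj : Function.Surjective π
  exact : ∀ q : Q, π q = 1 ↔ ∃ r : R, ι r = q
  ι_equiv : ∀ (r : R) (g : G), ι (AR.act r g) = AQ.act (ι r) g
  π_equiv : ∀ (q : Q) (g : G), π (AQ.act q g) = AS.act (π q) g
  central : ∀ (r : R) (q : Q), ι r * q = q * ι r

namespace GAction

variable {G Q : Type*} [Group G] [Group Q]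

lemma one_act (A : GAction G Q) (g : G) : A.act 1 g = 1 := by
  have h := A.act_map_mul g 1 1
  rw [mul_one] at h
  exact mul_eq_left.mp h.symm

/-- The inclusion of fixed points `Q^G → Q^B` is surjective iff every `B`-fixed point is
`G`-fixed. -/
lemma surjective_fixedPoints_restrict_iff (A : GAction G Q) (B : Subgroup G) :
    Function.Surjective (fun x : {q : Q // ∀ g : G, A.act q g = q} =>
        (⟨x.1, fun b => x.2 (b : G)⟩ : {q : Q // ∀ b : B, A.act q (b : G) = q})) ↔
      ∀ q : Q, (∀ b : B, A.act q (b : G) = q) → ∀ g : G, A.act q g = q := by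
  constructor
  · intro h q hq
    obtain ⟨⟨x, hx⟩, hxq⟩ := h ⟨q, hq⟩
    obtain rfl : x = q := congrArg Subtype.val hxq
    exact hx
  · rintro h ⟨q, hq⟩
    exact ⟨⟨q, h q hq⟩, rfl⟩

/-- The inclusion of fixed points `Q^G → Q^B` is injective. -/
lemma injective_fixedPoints_restrict (A : GAction G Q) (B : Subgroup G) :
    Function.Injective (fun x : {q : Q // ∀ g : G, A.act q g = q} =>
        (⟨x.1, fun b => x.2 (b : G)⟩ : {q : Q // ∀ b : B, A.act q (b : G) = q})) :=
  fun _ _ h => Subtype.ext (Subtype.mk.inj h)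

end GAction

/-- An element of `Q` whose image in `S` is `G`-fixed defines a cocycle `g ↦ q^g · q⁻¹` with
values in `R`. -/
lemma IsCentralExt.exists_connecting_cocycle
    {G R Q S : Type*} [Group G] [Group R] [Group Q] [Group S]
    {AR : GAction G R} {AQ : GAction G Q} {AS : GAction G S} {ι : R →* Q} {π : Q →* S}
    (hCE : IsCentralExt AR AQ AS ι π) (q : Q) (hq : ∀ g : G, AS.act (π q) g = π q) :
    ∃ γ : G → R, AR.IsCocycle γ ∧ ∀ g : G, AQ.act q g = ι (γ g) * q := by
  have key (g : G) : ∃ r : R, ι r = AQ.act q g * q⁻¹ :=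
    (hCE.exact _).mp (by rw [map_mul, map_inv, hCE.π_equiv, hq, mul_inv_cancel])
  choose γ hγ using key
  have hγ' (g : G) : AQ.act q g = ι (γ g) * q := by rw [hγ, inv_mul_cancel_right]
  refine ⟨γ, fun g h => hCE.ι_inj (mul_right_cancel (b := q) ?_), hγ'⟩
  rw [← hγ', ← AQ.act_mul, hγ' g, AQ.act_map_mul, hγ' h, map_mul, hCE.ι_equiv, mul_assoc]

/-- If `B`-fixed points of `R` and `S` are `G`-fixed and restriction `H¹(G,R) → H¹(B,R)` is
injective, then `B`-fixed points of `Q` are `G`-fixed. -/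
lemma IsCentralExt.fixed_of_fixed_subgroup
    {G R Q S : Type*} [Group G] [Group R] [Group Q] [Group S]
    {AR : GAction G R} {AQ : GAction G Q} {AS : GAction G S} {ι : R →* Q} {π : Q →* S}
    (hCE : IsCentralExt AR AQ AS ι π) (B : Subgroup G)
    (hH1 : ∀ γ δ : G → R, AR.IsCocycle γ → AR.IsCocycle δ →
      (AR.res B).Cohomologous (fun b => γ (b : G)) (fun b => δ (b : G)) →
      AR.Cohomologous γ δ)
    (hR : ∀ r : R, (∀ b : B, AR.act r (b : G) = r) → ∀ g : G, AR.act r g = r)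
    (hS : ∀ s : S, (∀ b : B, AS.act s (b : G) = s) → ∀ g : G, AS.act s g = s)
    (q : Q) (hq : ∀ b : B, AQ.act q (b : G) = q) (g : G) : AQ.act q g = q := by
  obtain ⟨γ, hγ, hγq⟩ := hCE.exists_connecting_cocycle q
    (hS (π q) fun b => by rw [← hCE.π_equiv, hq])
  have hγB (b : B) : γ (b : G) = 1 :=
    hCE.ι_inj (by rw [map_one, ← mul_eq_right (b := q), ← hγq, hq])
  obtain ⟨r, hr⟩ := hH1 γ (fun _ => 1) hγ (fun _ h => by rw [AR.one_act, mul_one])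
    ⟨1, fun b => by simp [hγB, (AR.res B).one_act]⟩
  have hrB (b : B) : AR.act r (b : G) = r := by
    have h := hr b
    rw [hγB, mul_one] at h
    exact inv_mul_eq_one.mp h.symm
  have hγ1 : γ g = 1 := by
    have h := hr g
    rw [hR r hrB g] at h
    have h' : r⁻¹ * γ g * (r⁻¹)⁻¹ = 1 := by rw [inv_inv]; exact h.symm
    exact conj_eq_one_iff.mp h'
  rw [hγq, hγ1, map_one, one_mul]

/-- five lemma for `H⁰`, restriction version. Let `B ≤ G` and
`1 → R → Q → S → 1` be a central extension of `G`-groups, and consider the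
restriction (inclusion) maps `R^G → R^B`, `Q^G → Q^B`, `S^G → S^B` on fixed points.
If `R^G → R^B` and `S^G → S^B` are surjective and `H¹(G,R) → H¹(B,R)` is injective,
then `Q^G → Q^B` is surjective; if `R^G → R^B` and `S^G → S^B` are injective, then
`Q^G → Q^B` is injective; hence if both are bijective (and `H¹(G,R) → H¹(B,R)` is
injective) then `Q^G → Q^B` is bijective. -/
theorem five_lemma_h0_restriction
    {G R Q S : Type*} [Group G] [Group R] [Group Q] [Group S]
    (AR : GAction G R) (AQ : GAction G Q) (AS : GAction G S)
    (ι : R →* Q) (π : Q →* S)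
    (hCE : IsCentralExt AR AQ AS ι π) (B : Subgroup G)
    -- `H¹(G,R) → H¹(B,R)` injective
    (h5 : ∀ γ δ : G → R, AR.IsCocycle γ → AR.IsCocycle δ →
      (AR.res B).Cohomologous (fun b => γ (b : G)) (fun b => δ (b : G)) →
      AR.Cohomologous γ δ) :
    ((Function.Surjective (fun x : {r : R // ∀ g : G, AR.act r g = r} =>
        (⟨x.1, fun b => x.2 (b : G)⟩ : {r : R // ∀ b : B, AR.act r (b : G) = r}))) →
     (Function.Surjective (fun x : {s : S // ∀ g : G, AS.act s g = s} =>
        (⟨x.1, fun b => x.2 (b : G)⟩ : {s : S // ∀ b : B, AS.act s (b : G) = s}))) →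
     Function.Surjective (fun x : {q : Q // ∀ g : G, AQ.act q g = q} =>
        (⟨x.1, fun b => x.2 (b : G)⟩ : {q : Q // ∀ b : B, AQ.act q (b : G) = q})))
    ∧ ((Function.Injective (fun x : {r : R // ∀ g : G, AR.act r g = r} =>
        (⟨x.1, fun b => x.2 (b : G)⟩ : {r : R // ∀ b : B, AR.act r (b : G) = r}))) →
     (Function.Injective (fun x : {s : S // ∀ g : G, AS.act s g = s} =>
        (⟨x.1, fun b => x.2 (b : G)⟩ : {s : S // ∀ b : B, AS.act s (b : G) = s}))) →
     Function.Injective (fun x : {q : Q // ∀ g : G, AQ.act q g = q} =>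
        (⟨x.1, fun b => x.2 (b : G)⟩ : {q : Q // ∀ b : B, AQ.act q (b : G) = q})))
    ∧ ((Function.Bijective (fun x : {r : R // ∀ g : G, AR.act r g = r} =>
        (⟨x.1, fun b => x.2 (b : G)⟩ : {r : R // ∀ b : B, AR.act r (b : G) = r}))) →
     (Function.Bijective (fun x : {s : S // ∀ g : G, AS.act s g = s} =>
        (⟨x.1, fun b => x.2 (b : G)⟩ : {s : S // ∀ b : B, AS.act s (b : G) = s}))) →
     Function.Bijective (fun x : {q : Q // ∀ g : G, AQ.act q g = q} =>
        (⟨x.1, fun b => x.2 (b : G)⟩ : {q : Q // ∀ b : B, AQ.act q (b : G) = q}))) := by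
  have surj := fun hR hS => (AQ.surjective_fixedPoints_restrict_iff B).mpr
    (hCE.fixed_of_fixed_subgroup B h5 ((AR.surjective_fixedPoints_restrict_iff B).mp hR)
      ((AS.surjective_fixedPoints_restrict_iff B).mp hS))
  have inj := AQ.injective_fixedPoints_restrict B
  exact ⟨surj, fun _ _ => inj, fun hR hS => ⟨inj, surj hR.2 hS.2⟩⟩
end

section
/- Let G be a group, B ≤ G a subgroup, and Q a G-group admitting a finite filtration Q = Q_1 ≥ Q_2 ≥ ⋯ ≥ Q_{n+1} = {1} in which each Q_i is normal in Q and stable under the G-action, and Q_i/Q_{i+1} ≤ Z(Q/Q_{i+1}) for each i (so each quotient Q_j/Q_{j+1} is an abelian G-group). Suppose that for every 1 ≤ j ≤ n: the restriction map H^1(G,Q_j/Q_{j+1}) → H^1(B,Q_j/Q_{j+1}) is bijective; the restriction map H^0(G,Q_j/Q_{j+1}) → H^0(B,Q_j/Q_{j+1}) is surjective; and the restriction map H^2(G,Q_j/Q_{j+1}) → H^2(B,Q_j/Q_{j+1}) is injective. Then the restriction map H^1(G,Q) → H^1(B,Q) is a bijection. -/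
namespace GAction

variable {G E S : Type*} [Group G] [Group E] [Group S]

/-- The endomorphism of `E` given by the action of `g`. -/
def toHom (A : GAction G E) (g : G) : E →* E where
  toFun q := A.act q g
  map_one' := by
    have h := A.act_map_mul g 1 1
    rw [one_mul] at h
    exact left_eq_mul.mp h
  map_mul' := A.act_map_mul g

lemma act_one_left (A : GAction G E) (g : G) : A.act 1 g = 1 := (A.toHom g).map_one

lemma act_inv (A : GAction G E) (q : E) (g : G) : A.act q⁻¹ g = (A.act q g)⁻¹ :=
  (A.toHom g).map_inv q

/-- The action induced on the quotient by a stable normal subgroup. -/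
def quotient (A : GAction G E) (K : Subgroup E) [K.Normal]
    (hK : ∀ q ∈ K, ∀ g : G, A.act q g ∈ K) : GAction G (E ⧸ K) where
  act e g := QuotientGroup.map K K (A.toHom g) (fun q hq => hK q hq g) e
  act_one e := by
    induction e using QuotientGroup.induction_on with
    | H q => exact congrArg _ (A.act_one q)
  act_mul e g h := by
    induction e using QuotientGroup.induction_on with
    | H q => exact congrArg _ (A.act_mul q g h)
  act_map_mul g := map_mul _

lemma IsCocycle.one (A : GAction G E) : A.IsCocycle fun _ => 1 := fun g h => by
  simp [A.act_one_left]

lemma IsCocycle.twist {A : GAction G E} {γ : G → E} (hγ : A.IsCocycle γ) (q : E) :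
    A.IsCocycle fun g => (A.act q g)⁻¹ * γ g * q := fun g h => by
  simp only [hγ g h, A.act_map_mul, A.act_inv, A.act_mul]
  group

lemma IsCocycle.map {A : GAction G E} {A' : GAction G S} {π : E →* S}
    (hπ : ∀ q g, π (A.act q g) = A'.act (π q) g) {γ : G → E} (hγ : A.IsCocycle γ) :
    A'.IsCocycle fun g => π (γ g) := fun g h => by
  simp only [hγ g h, map_mul, hπ]

lemma IsCocycle.mul_central {A : GAction G E} {γ ρ : G → E} (hγ : A.IsCocycle γ)
    (hρ : A.IsCocycle ρ)
    (hcA : ∀ g h q, A.act (ρ g) h * q = q * A.act (ρ g) h) :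
    A.IsCocycle fun g => γ g * ρ g := fun g h => by
  simp only [hγ g h, hρ g h, A.act_map_mul, mul_assoc]
  rw [← mul_assoc (γ h), ← hcA g h (γ h), mul_assoc]

lemma IsCocycle.inv_mul_central {A : GAction G E} {γ δ : G → E} (hγ : A.IsCocycle γ)
    (hδ : A.IsCocycle δ)
    (hcA : ∀ g h q, A.act ((γ g)⁻¹ * δ g) h * q = q * A.act ((γ g)⁻¹ * δ g) h) :
    A.IsCocycle fun g => (γ g)⁻¹ * δ g := fun g h => by
  have key := hcA g h (γ h)⁻¹
  simp only [← mul_assoc, hγ g h, hδ g h, mul_inv_rev]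
  rw [key, A.act_map_mul, A.act_inv]
  group

/-- Every 1-cocycle of `B` with values in `R` extends uniquely to a 1-cocycle of `G` with values
in `R`. -/
structure ExtendsUniquely (A : GAction G E) (B : Subgroup G) (R : Subgroup E) : Prop where
  eq_of_eqOn : ∀ γ δ : G → E, (∀ g, γ g ∈ R) → (∀ g, δ g ∈ R) → A.IsCocycle γ →
    A.IsCocycle δ → (∀ b : B, γ b = δ b) → ∀ g, γ g = δ g
  exists_extension : ∀ β : B → E, (∀ b, β b ∈ R) → (A.res B).IsCocycle β →
    ∃ γ : G → E, (∀ g, γ g ∈ R) ∧ A.IsCocycle γ ∧ ∀ b : B, γ b = β b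

/-- For central `R`, surjectivity in degree `0` and bijectivity in degree `1` of the restriction
on cohomology give bijectivity of the restriction on 1-cocycles. -/
lemma extendsUniquely_of_cohomology (A : GAction G E) (B : Subgroup G) (R : Subgroup E)
    (hc : ∀ r ∈ R, ∀ q : E, r * q = q * r) (hs : ∀ r ∈ R, ∀ g, A.act r g ∈ R)
    (h1s : ∀ β : B → E, (∀ b, β b ∈ R) → (A.res B).IsCocycle β →
      ∃ γ : G → E, (∀ g, γ g ∈ R) ∧ A.IsCocycle γ ∧
        ∃ q ∈ R, ∀ b : B, β b = (A.act q b)⁻¹ * γ b * q)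
    (h1i : ∀ γ δ : G → E, (∀ g, γ g ∈ R) → (∀ g, δ g ∈ R) → A.IsCocycle γ → A.IsCocycle δ →
      (∀ b : B, γ b = δ b) → ∃ q ∈ R, ∀ g, δ g = (A.act q g)⁻¹ * γ g * q)
    (h0 : ∀ q ∈ R, (∀ b : B, A.act q b = q) → ∀ g, A.act q g = q) :
    A.ExtendsUniquely B R where
  eq_of_eqOn γ δ hγR hδR hγ hδ hB := by
    obtain ⟨q, hq, h⟩ := h1i γ δ hγR hδR hγ hδ hB
    have hδ' : ∀ g, δ g = (A.act q g)⁻¹ * q * γ g := fun g => by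
      rw [h g, mul_assoc, mul_assoc, hc q hq]
    have hfix := h0 q hq fun b => by
      have := hδ' b
      rw [← hB b, right_eq_mul, inv_mul_eq_one] at this
      exact this
    intro g
    rw [hδ' g, hfix g, inv_mul_cancel, one_mul]
  exists_extension β hβR hβ := by
    obtain ⟨γ, hγR, hγ, q, hq, h⟩ := h1s β hβR hβ
    exact ⟨_, fun g => R.mul_mem (R.mul_mem (R.inv_mem (hs q hq g)) (hγR g)) hq, hγ.twist q,
      fun b => (h b).symm⟩

/-- The failure of a 1-cochain to be a 1-cocycle is a 2-cocycle, if it is central. -/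
lemma isTwoCocycle_of_central (A : GAction G E) (c : G → E) (τ : G → G → E)
    (hτ : ∀ g h, A.act (c g) h * c h = c (g * h) * τ g h)
    (hc : ∀ g h q, τ g h * q = q * τ g h)
    (hcA : ∀ g h k q, A.act (τ g h) k * q = q * A.act (τ g h) k) : A.IsTwoCocycle τ := by
  intro g h k
  have e₁ : A.act (A.act (c g) h * c h) k * c k
      = c (g * h * k) * (A.act (τ g h) k * τ (g * h) k) := by
    rw [hτ, A.act_map_mul, mul_assoc, hcA, ← mul_assoc, hτ, mul_assoc, hcA]
  have e₂ : A.act (A.act (c g) h * c h) k * c k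
      = c (g * h * k) * (τ h k * τ g (h * k)) := by
    rw [A.act_map_mul, A.act_mul, mul_assoc, hτ, ← mul_assoc, hτ, mul_assoc, hc h k,
      mul_assoc g h k]
  exact mul_left_cancel (e₁.symm.trans e₂)

/-- Unique extension of 1-cocycles passes from the kernel and the image of a central extension to
its middle term, if restriction in degree `2` is injective for the kernel. -/
lemma ExtendsUniquely.of_central_extension {A : GAction G E} {A' : GAction G S} {B : Subgroup G}
    {π : E →* S} (hsurj : Function.Surjective π) (hπ : ∀ q g, π (A.act q g) = A'.act (π q) g)
    (hc : ∀ r ∈ π.ker, ∀ q : E, r * q = q * r)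
    (hR : A.ExtendsUniquely B π.ker) (hS : A'.ExtendsUniquely B ⊤)
    (h2 : ∀ τ : G → G → E, (∀ g h, τ g h ∈ π.ker) → A.IsTwoCocycle τ →
      (∀ b c : B, τ b c = 1) → ∃ φ : G → E, (∀ g, φ g ∈ π.ker) ∧
        ∀ g h, τ g h = A.act (φ g) h * φ h * (φ (g * h))⁻¹) :
    A.ExtendsUniquely B ⊤ := by
  have hs : ∀ r ∈ π.ker, ∀ g, A.act r g ∈ π.ker := fun r hr g => by
    rw [MonoidHom.mem_ker] at hr ⊢
    rw [hπ, hr, A'.act_one_left]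
  constructor
  · intro γ δ _ _ hγ hδ hB g
    have hker : ∀ g, (γ g)⁻¹ * δ g ∈ π.ker := fun g => by
      have := hS.eq_of_eqOn _ _ (fun _ => trivial) (fun _ => trivial) (hγ.map hπ) (hδ.map hπ)
        (fun b => congrArg π (hB b)) g
      rw [MonoidHom.mem_ker, map_mul, map_inv, this, inv_mul_cancel]
    have := hR.eq_of_eqOn _ _ hker (fun _ => π.ker.one_mem)
      (hγ.inv_mul_central hδ fun g h => hc _ (hs _ (hker g) h)) (IsCocycle.one A)
      (fun b => by rw [hB b, inv_mul_cancel]) g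
    exact inv_mul_eq_one.mp this
  · intro β _ hβ
    obtain ⟨γ', -, hγ', hγβ⟩ := hS.exists_extension (fun b => π (β b)) (fun _ => trivial)
      (fun b c => by
        simp only [hβ b c, map_mul]
        exact congrArg (· * _) (hπ (β b) c))
    obtain ⟨c, hcπ, hcB⟩ : ∃ c : G → E, (∀ g, π (c g) = γ' g) ∧ ∀ b : B, c b = β b := by
      have : ∀ g, ∃ x : E, π x = γ' g ∧ ∀ b : B, (b : G) = g → x = β b := fun g => by
        by_cases hg : g ∈ B
        · refine ⟨β ⟨g, hg⟩, (hγβ ⟨g, hg⟩).symm, ?_⟩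
          rintro b rfl
          rfl
        · obtain ⟨x, hx⟩ := hsurj (γ' g)
          exact ⟨x, hx, fun b hb => absurd (hb ▸ b.2) hg⟩
      choose c hc₁ hc₂ using this
      exact ⟨c, hc₁, fun b => hc₂ b b rfl⟩
    let τ : G → G → E := fun g h => (c (g * h))⁻¹ * (A.act (c g) h * c h)
    have hτ : ∀ g h, A.act (c g) h * c h = c (g * h) * τ g h := fun g h =>
      (mul_inv_cancel_left _ _).symm
    have hτR : ∀ g h, τ g h ∈ π.ker := fun g h => by
      rw [MonoidHom.mem_ker]
      simp only [τ, map_mul, map_inv, hπ, hcπ, hγ' g h, inv_mul_cancel]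
    have hτB : ∀ b d : B, τ b d = 1 := fun b d => by
      have h₁ : c ((b : G) * d) = β (b * d) := hcB (b * d)
      have h₂ : β (b * d) = A.act (β b) d * β d := hβ b d
      simp only [τ, h₁, h₂, hcB, inv_mul_cancel]
    obtain ⟨φ, hφR, hφ⟩ := h2 τ hτR
      (A.isTwoCocycle_of_central c τ hτ (fun g h => hc _ (hτR g h))
        fun g h k => hc _ (hs _ (hτR g h) k)) hτB
    obtain ⟨ρ, hρR, hρ, hρB⟩ := hR.exists_extension (fun b => φ b) (fun b => hφR b)
      (fun b d => by
        have := hφ b d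
        rw [hτB, eq_mul_inv_iff_mul_eq, one_mul] at this
        exact this)
    have hcoc : A.IsCocycle fun g => c g * (φ g)⁻¹ := fun g h => by
      have e₁ : c (g * h) = A.act (c g) h * c h * (τ g h)⁻¹ := by
        rw [hτ, mul_inv_cancel_right]
      have e₂ := hc _ (π.ker.inv_mem (hs _ (hφR g) h)) (c h)
      have e₃ := hc _ (π.ker.inv_mem (hs _ (hφR g) h)) (φ h)⁻¹
      simp only [e₁, hφ g h, A.act_map_mul, A.act_inv, mul_inv_rev, inv_inv]
      calc _ = A.act (c g) h * (c h * ((φ h)⁻¹ * (A.act (φ g) h)⁻¹)) := by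
            have e₄ := hc _ (hφR (g * h)) ((φ h)⁻¹ * (A.act (φ g) h)⁻¹)
            rw [e₄]
            group
        _ = _ := by
            rw [← e₃, ← mul_assoc (c h), ← e₂]
            group
    refine ⟨_, fun _ => trivial, hcoc.mul_central hρ
      (fun g h => hc _ (hs _ (hρR g) h)), fun b => ?_⟩
    simp only [hρB b, hcB b, inv_mul_cancel_right]

/-- Unique extension of 1-cocycles passes from `E / M` to `E / K` when `M / K` is central and
satisfies the cohomological conditions, expressed through representatives in `M`. -/
lemma ExtendsUniquely.quotient_succ (A : GAction G E) (B : Subgroup G) (M K : Subgroup E)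
    [M.Normal] [K.Normal] (hKM : K ≤ M) (hM : ∀ q ∈ M, ∀ g : G, A.act q g ∈ M)
    (hK : ∀ q ∈ K, ∀ g : G, A.act q g ∈ K)
    (hcentral : ∀ q ∈ M, ∀ q' : E, q * q' * q⁻¹ * q'⁻¹ ∈ K)
    (h1s : ∀ β : B → E, (∀ b : B, β b ∈ M) →
      (∀ b c : B, (β (b * c))⁻¹ * (A.act (β b) (c : G) * β c) ∈ K) →
      ∃ γ : G → E, (∀ g : G, γ g ∈ M) ∧
        (∀ g h : G, (γ (g * h))⁻¹ * (A.act (γ g) h * γ h) ∈ K) ∧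
        ∃ q ∈ M, ∀ b : B, (β b)⁻¹ * ((A.act q (b : G))⁻¹ * γ (b : G) * q) ∈ K)
    (h1i : ∀ γ δ : G → E, (∀ g : G, γ g ∈ M) → (∀ g : G, δ g ∈ M) →
      (∀ g h : G, (γ (g * h))⁻¹ * (A.act (γ g) h * γ h) ∈ K) →
      (∀ g h : G, (δ (g * h))⁻¹ * (A.act (δ g) h * δ h) ∈ K) →
      (∃ q ∈ M, ∀ b : B, (δ (b : G))⁻¹ * ((A.act q (b : G))⁻¹ * γ (b : G) * q) ∈ K) →
      ∃ q ∈ M, ∀ g : G, (δ g)⁻¹ * ((A.act q g)⁻¹ * γ g * q) ∈ K)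
    (h0 : ∀ q ∈ M, (∀ b : B, (A.act q (b : G))⁻¹ * q ∈ K) →
      ∃ q' ∈ M, (∀ g : G, (A.act q' g)⁻¹ * q' ∈ K) ∧ q'⁻¹ * q ∈ K)
    (h2 : ∀ τ τ' : G → G → E, (∀ g h : G, τ g h ∈ M) → (∀ g h : G, τ' g h ∈ M) →
      (∀ g h k : G, (A.act (τ g h) k * τ (g * h) k)⁻¹ * (τ h k * τ g (h * k)) ∈ K) →
      (∀ g h k : G, (A.act (τ' g h) k * τ' (g * h) k)⁻¹ * (τ' h k * τ' g (h * k)) ∈ K) →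
      (∃ φ : B → E, (∀ b : B, φ b ∈ M) ∧ ∀ b c : B,
        (τ' (b : G) (c : G))⁻¹ *
          (τ (b : G) (c : G) * A.act (φ b) (c : G) * φ c * (φ (b * c))⁻¹) ∈ K) →
      ∃ φ : G → E, (∀ g : G, φ g ∈ M) ∧ ∀ g h : G,
        (τ' g h)⁻¹ * (τ g h * A.act (φ g) h * φ h * (φ (g * h))⁻¹) ∈ K)
    (hS : (A.quotient M hM).ExtendsUniquely B ⊤) :
    (A.quotient K hK).ExtendsUniquely B ⊤ := by
  let π : E ⧸ K →* E ⧸ M := QuotientGroup.map K M (MonoidHom.id E) hKM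
  have hmem : ∀ q : E, (q : E ⧸ K) ∈ π.ker ↔ q ∈ M := fun q => by
    rw [MonoidHom.mem_ker]
    exact QuotientGroup.eq_one_iff q
  have hlift : ∀ e ∈ π.ker, ∃ q ∈ M, (q : E ⧸ K) = e := fun e he => by
    obtain ⟨q, rfl⟩ := QuotientGroup.mk_surjective e
    exact ⟨q, (hmem q).mp he, rfl⟩
  have hπ : ∀ e g, π ((A.quotient K hK).act e g) = (A.quotient M hM).act (π e) g := fun e g => by
    induction e using QuotientGroup.induction_on with
    | H q => rfl
  have hc : ∀ r ∈ π.ker, ∀ e : E ⧸ K, r * e = e * r := fun r hr e => by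
    obtain ⟨q, hq, rfl⟩ := hlift r hr
    obtain ⟨q', rfl⟩ := QuotientGroup.mk_surjective e
    have := (QuotientGroup.eq_one_iff (N := K) _).mpr (hcentral q hq q')
    simp only [QuotientGroup.mk_mul, QuotientGroup.mk_inv] at this
    rwa [mul_inv_eq_one, mul_inv_eq_iff_eq_mul] at this
  have hs : ∀ r ∈ π.ker, ∀ g, (A.quotient K hK).act r g ∈ π.ker := fun r hr g => by
    rw [MonoidHom.mem_ker] at hr ⊢
    rw [hπ, hr, act_one_left]
  have hsurj : Function.Surjective π := fun e => by
    obtain ⟨q, rfl⟩ := QuotientGroup.mk_surjective e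
    exact ⟨(q : E ⧸ K), rfl⟩
  refine of_central_extension hsurj hπ hc
    (extendsUniquely_of_cohomology _ B π.ker hc hs ?_ ?_ ?_) hS ?_
  · intro β hβR hβ
    choose β' hβM hβ' using fun b => hlift (β b) (hβR b)
    obtain rfl : (fun b => (β' b : E ⧸ K)) = β := funext hβ'
    obtain ⟨γ, hγM, hγ, q, hq, h⟩ := h1s β' hβM fun b c => QuotientGroup.eq.mp (hβ b c)
    exact ⟨fun g => γ g, fun g => (hmem _).mpr (hγM g),
      fun g h => QuotientGroup.eq.mpr (hγ g h), q, (hmem q).mpr hq,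
      fun b => QuotientGroup.eq.mpr (h b)⟩
  · intro γ δ hγR hδR hγ hδ hB
    choose γ' hγM hγ' using fun g => hlift (γ g) (hγR g)
    obtain rfl : (fun g => (γ' g : E ⧸ K)) = γ := funext hγ'
    choose δ' hδM hδ' using fun g => hlift (δ g) (hδR g)
    obtain rfl : (fun g => (δ' g : E ⧸ K)) = δ := funext hδ'
    obtain ⟨q, hq, h⟩ := h1i γ' δ' hγM hδM (fun g h => QuotientGroup.eq.mp (hγ g h))
      (fun g h => QuotientGroup.eq.mp (hδ g h)) ⟨1, M.one_mem, fun b => by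
        rw [A.act_one_left, inv_one, one_mul, mul_one]
        exact QuotientGroup.eq.mp (hB b).symm⟩
    exact ⟨q, (hmem q).mpr hq, fun g => QuotientGroup.eq.mpr (h g)⟩
  · intro e he hB g
    obtain ⟨q, hq, rfl⟩ := hlift e he
    obtain ⟨q', -, hfix, hqq'⟩ := h0 q hq fun b => QuotientGroup.eq.mp (hB b)
    rw [← QuotientGroup.eq.mpr hqq']
    exact QuotientGroup.eq.mpr (hfix g)
  · intro τ hτR hτ hB
    choose τ' hτM hτ' using fun g h => hlift (τ g h) (hτR g h)
    obtain rfl : (fun g h => (τ' g h : E ⧸ K)) = τ := funext fun g => funext (hτ' g)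
    obtain ⟨φ, hφM, hφ⟩ := h2 (fun _ _ => 1) τ' (fun _ _ => M.one_mem) hτM
      (fun g h k => by simp [A.act_one_left])
      (fun g h k => QuotientGroup.eq.mp (hτ g h k))
      ⟨fun _ => 1, fun _ => M.one_mem, fun b c => by
        simpa [A.act_one_left] using (QuotientGroup.eq_one_iff _).mp (hB b c)⟩
    simp only [one_mul] at hφ
    exact ⟨fun g => φ g, fun g => (hmem _).mpr (hφM g),
      fun g h => QuotientGroup.eq.mpr (hφ g h)⟩

end GAction

/-- Corollary for filtered `G`-groups, restriction version.
Let `B ≤ G` and let `Q` be a `G`-group with a finite central filtration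
`Q = N 1 ≥ N 2 ≥ ⋯ ≥ N (n+1) = 1` by `G`-stable normal subgroups with
`N i / N (i+1) ≤ Z(Q / N (i+1))`.  Cohomology with coefficients in the (abelian)
`G`-group `N j / N (j+1)` is encoded via representatives: an element of the
quotient is represented by an element of `N j`, two representatives representing
the same element iff their "quotient" lies in `N (j+1)`.
If for all `1 ≤ j ≤ n` restriction `H¹(G, N j/N (j+1)) → H¹(B, N j/N (j+1))` is
bijective, `H⁰(G, N j/N (j+1)) → H⁰(B, N j/N (j+1))` is surjective and
`H²(G, N j/N (j+1)) → H²(B, N j/N (j+1))` is injective, then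
`H¹(G,Q) → H¹(B,Q)` is a bijection. -/
theorem filtered_h1_restriction_bijective
    {G Q : Type*} [Group G] [Group Q]
    (A : GAction G Q) (B : Subgroup G) (n : ℕ) (N : ℕ → Subgroup Q)
    (hN1 : N 1 = ⊤) (hNlast : N (n + 1) = ⊥)
    (hmono : ∀ i : ℕ, N (i + 1) ≤ N i)
    (hnormal : ∀ i : ℕ, (N i).Normal)
    (hstable : ∀ i : ℕ, ∀ q ∈ N i, ∀ g : G, A.act q g ∈ N i)
    (hcentral : ∀ i : ℕ, ∀ q ∈ N i, ∀ q' : Q, q * q' * q⁻¹ * q'⁻¹ ∈ N (i + 1))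
    -- `H¹(G, N j/N (j+1)) → H¹(B, N j/N (j+1))` is surjective for `1 ≤ j ≤ n`
    (h1s : ∀ j : ℕ, 1 ≤ j → j ≤ n →
      ∀ β : B → Q, (∀ b : B, β b ∈ N j) →
      (∀ b c : B, (β (b * c))⁻¹ * (A.act (β b) (c : G) * β c) ∈ N (j + 1)) →
      ∃ γ : G → Q, (∀ g : G, γ g ∈ N j) ∧
        (∀ g h : G, (γ (g * h))⁻¹ * (A.act (γ g) h * γ h) ∈ N (j + 1)) ∧
        ∃ q ∈ N j, ∀ b : B, (β b)⁻¹ * ((A.act q (b : G))⁻¹ * γ (b : G) * q) ∈ N (j + 1))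
    -- `H¹(G, N j/N (j+1)) → H¹(B, N j/N (j+1))` is injective for `1 ≤ j ≤ n`
    (h1i : ∀ j : ℕ, 1 ≤ j → j ≤ n →
      ∀ γ δ : G → Q, (∀ g : G, γ g ∈ N j) → (∀ g : G, δ g ∈ N j) →
      (∀ g h : G, (γ (g * h))⁻¹ * (A.act (γ g) h * γ h) ∈ N (j + 1)) →
      (∀ g h : G, (δ (g * h))⁻¹ * (A.act (δ g) h * δ h) ∈ N (j + 1)) →
      (∃ q ∈ N j, ∀ b : B, (δ (b : G))⁻¹ * ((A.act q (b : G))⁻¹ * γ (b : G) * q) ∈ N (j + 1)) →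
      ∃ q ∈ N j, ∀ g : G, (δ g)⁻¹ * ((A.act q g)⁻¹ * γ g * q) ∈ N (j + 1))
    -- `H⁰(G, N j/N (j+1)) → H⁰(B, N j/N (j+1))` is surjective for `1 ≤ j ≤ n`
    (h0 : ∀ j : ℕ, 1 ≤ j → j ≤ n →
      ∀ q ∈ N j, (∀ b : B, (A.act q (b : G))⁻¹ * q ∈ N (j + 1)) →
      ∃ q' ∈ N j, (∀ g : G, (A.act q' g)⁻¹ * q' ∈ N (j + 1)) ∧ q'⁻¹ * q ∈ N (j + 1))
    -- `H²(G, N j/N (j+1)) → H²(B, N j/N (j+1))` is injective for `1 ≤ j ≤ n`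
    (h2 : ∀ j : ℕ, 1 ≤ j → j ≤ n →
      ∀ τ τ' : G → G → Q, (∀ g h : G, τ g h ∈ N j) → (∀ g h : G, τ' g h ∈ N j) →
      (∀ g h k : G, (A.act (τ g h) k * τ (g * h) k)⁻¹ * (τ h k * τ g (h * k)) ∈ N (j + 1)) →
      (∀ g h k : G, (A.act (τ' g h) k * τ' (g * h) k)⁻¹ * (τ' h k * τ' g (h * k)) ∈ N (j + 1)) →
      (∃ φ : B → Q, (∀ b : B, φ b ∈ N j) ∧ ∀ b c : B,
        (τ' (b : G) (c : G))⁻¹ *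
          (τ (b : G) (c : G) * A.act (φ b) (c : G) * φ c * (φ (b * c))⁻¹) ∈ N (j + 1)) →
      ∃ φ : G → Q, (∀ g : G, φ g ∈ N j) ∧ ∀ g h : G,
        (τ' g h)⁻¹ * (τ g h * A.act (φ g) h * φ h * (φ (g * h))⁻¹) ∈ N (j + 1)) :
    -- `H¹(G,Q) → H¹(B,Q)` is a bijection
    (∀ β : B → Q, (A.res B).IsCocycle β →
      ∃ γ : G → Q, A.IsCocycle γ ∧ (A.res B).Cohomologous (fun b => γ (b : G)) β)
    ∧ (∀ γ δ : G → Q, A.IsCocycle γ → A.IsCocycle δ →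
      (A.res B).Cohomologous (fun b => γ (b : G)) (fun b => δ (b : G)) →
      A.Cohomologous γ δ) := by
  have hquot : ∀ j, j ≤ n → ∀ (_ : (N (j + 1)).Normal),
      (A.quotient (N (j + 1)) (hstable (j + 1))).ExtendsUniquely B ⊤ := by
    intro j
    induction j with
    | zero =>
      intro _ _
      have : Subsingleton (Q ⧸ N (0 + 1)) := by
        rw [zero_add, hN1]
        exact QuotientGroup.subsingleton_quotient_top
      exact ⟨fun _ _ _ _ _ _ _ _ => Subsingleton.elim _ _, fun _ _ _ =>
        ⟨fun _ => 1, fun _ => trivial, fun _ _ => Subsingleton.elim _ _,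
          fun _ => Subsingleton.elim _ _⟩⟩
    | succ j ih =>
      intro hj hnorm
      have hnorm' := hnormal (j + 1)
      exact GAction.ExtendsUniquely.quotient_succ A B (N (j + 1)) (N (j + 1 + 1))
        (hmono _) (hstable _) (hstable _) (hcentral _) (h1s _ (by omega) hj)
        (h1i _ (by omega) hj) (h0 _ (by omega) hj) (h2 _ (by omega) hj)
        (ih (by omega) hnorm')
  have hnorm := hnormal (n + 1)
  have hker : ∀ r ∈ (QuotientGroup.mk' (N (n + 1))).ker, r = 1 := fun r hr => by
    rwa [QuotientGroup.ker_mk', hNlast, Subgroup.mem_bot] at hr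
  have main : A.ExtendsUniquely B ⊤ := by
    refine GAction.ExtendsUniquely.of_central_extension
      (QuotientGroup.mk'_surjective (N (n + 1))) (fun _ _ => rfl)
      (fun r hr q => by rw [hker r hr, one_mul, mul_one]) ⟨?_, ?_⟩
      (hquot n le_rfl hnorm) ?_
    · intro γ δ hγ hδ _ _ _ g
      rw [hker _ (hγ g), hker _ (hδ g)]
    · exact fun β hβ _ => ⟨fun _ => 1, fun _ => one_mem _, GAction.IsCocycle.one A,
        fun b => (hker _ (hβ b)).symm⟩
    · exact fun τ hτ _ _ => ⟨fun _ => 1, fun _ => one_mem _, fun g h => by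
        simp [hker _ (hτ g h), A.act_one_left]⟩
  refine ⟨fun β hβ => ?_, fun γ δ hγ hδ ⟨q, hq⟩ => ⟨q, fun g => ?_⟩⟩
  · obtain ⟨γ, -, hγ, h⟩ := main.exists_extension β (fun _ => trivial) hβ
    exact ⟨γ, hγ, 1, fun b => by simp [(A.res B).act_one_left, h b]⟩
  · exact main.eq_of_eqOn _ _ (fun _ => trivial) (fun _ => trivial) hδ (hγ.twist q) hq g
end
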